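/- Let β < 0, 0 < α < 8/(d+n), c > c₋ where c₋ := inf{c > 0 : m_c < -β²c/8}, and let (u_n) ⊂ S(c) be a minimizing sequence for m_c. Then liminf_{n→∞} ‖u_n‖_{α+2}^{α+2} ≥ c(α+2)(-c^{-1}m_c - β²/8) > 0. -/

import Mathlib

noncomputable section

open MeasureTheory Real Filter Set

namespace BNLS

/-- A point of `ℝ^d × 𝕋^n`, the torus being modelled by periodic functions on `ℝ^n`. -/
abbrev Pt (d n : ℕ) := (Fin d → ℝ) × (Fin n → ℝ)

/-- Fundamental domain `[0,2π)^n` of the torus `(ℝ/2πℤ)^n`. -/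
def torusBox (n : ℕ) : Set (Fin n → ℝ) := Set.univ.pi fun _ => Set.Ico 0 (2*π)

/-- The measure of the torus `𝕋^n`. -/
def μT (n : ℕ) : Measure (Fin n → ℝ) := volume.restrict (torusBox n)

/-- The measure of `ℝ^d × 𝕋^n`. -/
def μP (d n : ℕ) : Measure (Pt d n) := (volume : Measure (Fin d → ℝ)).prod (μT n)

/-- Partial derivative in the `i`-th `x`-direction. -/
def dX (d n : ℕ) (i : Fin d) (u : Pt d n → ℂ) : Pt d n → ℂ :=
  fun p => fderiv ℝ u p (Pi.single i 1, 0)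

/-- Partial derivative in the `j`-th `y`-direction. -/
def dY (d n : ℕ) (j : Fin n) (u : Pt d n → ℂ) : Pt d n → ℂ :=
  fun p => fderiv ℝ u p (0, Pi.single j 1)

/-- Partial Laplacian `Δ_x`. -/
def lapX (d n : ℕ) (u : Pt d n → ℂ) : Pt d n → ℂ := fun p => ∑ i, dX d n i (dX d n i u) p

/-- Partial Laplacian `Δ_y`. -/
def lapY (d n : ℕ) (u : Pt d n → ℂ) : Pt d n → ℂ := fun p => ∑ j, dY d n j (dY d n j u) p

/-- Full Laplacian `Δ_{x,y}`. -/
def lap (d n : ℕ) (u : Pt d n → ℂ) : Pt d n → ℂ := fun p => lapX d n u p + lapY d n u p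

/-- Mass `‖u‖_{L²}²`. -/
def Mass (d n : ℕ) (u : Pt d n → ℂ) : ℝ := ∫ z, ‖u z‖^2 ∂(μP d n)

/-- `‖u‖_{L^p}^p`. -/
def Npow (d n : ℕ) (p : ℝ) (u : Pt d n → ℂ) : ℝ := ∫ z, ‖u z‖ ^ p ∂(μP d n)

/-- The `L^p` norm. -/
def LpN (d n : ℕ) (p : ℝ) (u : Pt d n → ℂ) : ℝ := (Npow d n p u) ^ (1/p)

/-- `‖Δ u‖_{L²}²`. -/
def lapSq (d n : ℕ) (u : Pt d n → ℂ) : ℝ := ∫ z, ‖lap d n u z‖^2 ∂(μP d n)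

/-- `‖Δ_x u‖_{L²}²`. -/
def lapXSq (d n : ℕ) (u : Pt d n → ℂ) : ℝ := ∫ z, ‖lapX d n u z‖^2 ∂(μP d n)

/-- `‖Δ_y u‖_{L²}²`. -/
def lapYSq (d n : ℕ) (u : Pt d n → ℂ) : ℝ := ∫ z, ‖lapY d n u z‖^2 ∂(μP d n)

/-- `‖∇_x u‖_{L²}²`. -/
def gradXSq (d n : ℕ) (u : Pt d n → ℂ) : ℝ := ∫ z, (∑ i, ‖dX d n i u z‖^2) ∂(μP d n)

/-- `‖∇_y u‖_{L²}²`. -/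
def gradYSq (d n : ℕ) (u : Pt d n → ℂ) : ℝ := ∫ z, (∑ j, ‖dY d n j u z‖^2) ∂(μP d n)

/-- `‖∇ u‖_{L²}²`. -/
def gradSq (d n : ℕ) (u : Pt d n → ℂ) : ℝ := gradXSq d n u + gradYSq d n u

/-- Pointwise sum of squares of all second derivatives. -/
def hessInt (d n : ℕ) (u : Pt d n → ℂ) (z : Pt d n) : ℝ :=
  (∑ i, ∑ i', ‖dX d n i (dX d n i' u) z‖^2) + (∑ i, ∑ j, ‖dY d n j (dX d n i u) z‖^2)
  + (∑ j, ∑ i, ‖dX d n i (dY d n j u) z‖^2) + (∑ j, ∑ j', ‖dY d n j (dY d n j' u) z‖^2)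

/-- `‖∇² u‖_{L²}²`. -/
def hessSq (d n : ℕ) (u : Pt d n → ℂ) : ℝ := ∫ z, hessInt d n u z ∂(μP d n)

/-- The `H²` norm on `ℝ^d × 𝕋^n`. -/
def H2norm (d n : ℕ) (u : Pt d n → ℂ) : ℝ :=
  Real.sqrt (Mass d n u + gradSq d n u + hessSq d n u)

/-- `2π`-periodicity in all `y`-variables. -/
def Periodic (d n : ℕ) (u : Pt d n → ℂ) : Prop :=
  ∀ j : Fin n, ∀ p : Pt d n, u (p.1, p.2 + (2*π) • (Pi.single j 1 : Fin n → ℝ)) = u p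

/-- Membership in `H²(ℝ^d × 𝕋^n)`. -/
def InH2 (d n : ℕ) (u : Pt d n → ℂ) : Prop :=
  ContDiff ℝ 2 u ∧ Periodic d n u ∧
  Integrable (fun z => ‖u z‖^2) (μP d n) ∧
  Integrable (fun z => (∑ i, ‖dX d n i u z‖^2) + ∑ j, ‖dY d n j u z‖^2) (μP d n) ∧
  Integrable (hessInt d n u) (μP d n)

/-- The mass sphere `S(c)`. -/
def Sset (d n : ℕ) (c : ℝ) : Set (Pt d n → ℂ) := {u | InH2 d n u ∧ Mass d n u = c}

/-- The energy functional `E`. -/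
def En (d n : ℕ) (β α : ℝ) (u : Pt d n → ℂ) : ℝ :=
  (1/2) * lapSq d n u + (β/2) * gradSq d n u - (1/(α+2)) * Npow d n (α+2) u

/-- The ground state energy `m_c`. -/
def mC (d n : ℕ) (β α c : ℝ) : ℝ := sInf (En d n β α '' Sset d n c)

end BNLS

namespace BNLS

/-- The full box. -/
def dom (d n : ℕ) : Set (Pt d n) := Set.univ ×ˢ torusBox n

lemma μP_eq (d n : ℕ) : μP d n = (volume : Measure (Pt d n)).restrict (dom d n) := by
  unfold μP μT dom
  rw [Measure.volume_eq_prod, ← Measure.prod_restrict, Measure.restrict_univ]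

instance (d n : ℕ) : SFinite (μP d n) := by rw [μP_eq]; infer_instance
instance (d n : ℕ) : SigmaFinite (μP d n) := by rw [μP_eq]; infer_instance

lemma measurableSet_dom (d n : ℕ) : MeasurableSet (dom d n) :=
  MeasurableSet.univ.prod (MeasurableSet.univ_pi fun _ => measurableSet_Ico)

/-- generic periodicity -/
def PerG {B : Type*} (d n : ℕ) (f : Pt d n → B) : Prop :=
  ∀ j : Fin n, ∀ p : Pt d n, f (p.1, p.2 + (2*π) • (Pi.single j 1 : Fin n → ℝ)) = f p

/-- lattice hom -/
def latHom (d n : ℕ) : (Fin n → ℤ) →+ Pt d n where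
  toFun k := (0, fun j => k j • (2*π))
  map_zero' := by ext <;> simp
  map_add' a b := by ext <;> simp [add_mul]

/-- lattice -/
def lat (d n : ℕ) : AddSubgroup (Pt d n) := (latHom d n).range

instance (d n : ℕ) : Countable (lat d n) := by
  unfold lat
  exact Set.countable_coe_iff.2 (Set.countable_range (latHom d n))

lemma perG_lat {B : Type*} {d n : ℕ} {f : Pt d n → B} (hf : PerG d n f) (g : lat d n) (x : Pt d n) :
    f (g +ᵥ x) = f x := by
  let H : AddSubgroup (Pt d n) :=
    { carrier := {g | ∀ p, f (p + g) = f p}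
      zero_mem' := by intro p; simp
      add_mem' := by
        intro a b ha hb p
        rw [← add_assoc, hb, ha]
      neg_mem' := by
        intro a ha p
        have := ha (p + -a)
        rw [← this]; simp }
  obtain ⟨g, k, rfl⟩ := g
  have key : latHom d n k ∈ H := by
    have : latHom d n k = ∑ j, k j • ((0, (2*π) • (Pi.single j 1 : Fin n → ℝ)) : Pt d n) := by
      ext i
      · simp [latHom, Prod.fst_sum]
      · simp [latHom, Prod.snd_sum, Finset.sum_apply, Pi.single_apply, mul_comm]
    rw [this]
    refine sum_mem fun j _ => zsmul_mem ?_ _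
    intro p
    have := hf j p
    rw [← this]
    congr 1
    ext <;> simp
  have := key x
  rw [← this]
  change f (latHom d n k + x) = _
  rw [add_comm]

lemma fund (d n : ℕ) : IsAddFundamentalDomain (lat d n) (dom d n) (volume : Measure (Pt d n)) := by
  refine IsAddFundamentalDomain.mk' (measurableSet_dom d n).nullMeasurableSet fun x => ?_
  have h2 : (0:ℝ) < 2*π := by positivity
  choose k hk hk' using fun j => existsUnique_add_zsmul_mem_Ico h2 (x.2 j) 0
  refine ⟨⟨latHom d n k, k, rfl⟩, ?_, ?_⟩
  · refine ⟨mem_univ _, fun j _ => ?_⟩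
    have := hk j
    simp only [zero_add] at this
    change (k j • (2*π) + x.2 j) ∈ _
    rwa [add_comm]
  · rintro ⟨_, k', rfl⟩ h
    have : k' = k := by
      funext j
      apply hk' j
      have := h.2 j (mem_univ _)
      change (k' j • (2*π) + x.2 j) ∈ _ at this
      simpa only [zero_add, add_comm] using this
    subst this; rfl

open scoped Pointwise

instance (d n : ℕ) : (volume : Measure (Pt d n)).IsAddLeftInvariant := by
  rw [Measure.volume_eq_prod]; infer_instance

instance (d n : ℕ) : VAddInvariantMeasure (Pt d n) (Pt d n) volume :=
  ⟨fun c _ _ => measure_preimage_add volume c _⟩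

instance (d n : ℕ) : VAddInvariantMeasure (lat d n) (Pt d n) volume :=
  ⟨fun c _ _ => measure_preimage_add volume (c : Pt d n) _⟩

lemma fund' (d n : ℕ) (a : Pt d n) :
    IsAddFundamentalDomain (lat d n) (a +ᵥ dom d n) (volume : Measure (Pt d n)) :=
  (fund d n).vadd_of_comm a

lemma lint_trans {d n : ℕ} {f : Pt d n → ENNReal} (hf : PerG d n f) (a : Pt d n) :
    ∫⁻ x, f (x + a) ∂(μP d n) = ∫⁻ x, f x ∂(μP d n) := by
  rw [μP_eq, (fund d n).setLIntegral_eq (fund' d n a) f (perG_lat hf)]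
  have := (measurePreserving_add_left (volume : Measure (Pt d n)) a).setLIntegral_comp_emb
    (measurableEmbedding_addLeft a) f (dom d n)
  simp only [add_comm _ a]
  exact this

lemma int_trans {d n : ℕ} {V : Type*} [NormedAddCommGroup V] [NormedSpace ℝ V]
    {f : Pt d n → V} (hf : PerG d n f) (a : Pt d n) :
    ∫ x, f (x + a) ∂(μP d n) = ∫ x, f x ∂(μP d n) := by
  rw [μP_eq, (fund d n).setIntegral_eq (fund' d n a) (perG_lat hf)]
  have := (measurePreserving_add_left (volume : Measure (Pt d n)) a).setIntegral_image_emb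
    (measurableEmbedding_addLeft a) f (dom d n)
  simp only [add_comm _ a]
  exact this.symm

lemma integrable_trans {d n : ℕ} {V : Type*} [NormedAddCommGroup V] 
    {f : Pt d n → V} (hf : PerG d n f) (hi : Integrable f (μP d n)) (a : Pt d n) :
    Integrable (fun x => f (x + a)) (μP d n) := by
  rw [μP_eq] at hi ⊢
  have h1 := ((fund d n).integrableOn_iff (fund' d n a) (perG_lat hf)).1 hi
  have := ((measurePreserving_add_left (volume : Measure (Pt d n)) a).integrableOn_image
    (measurableEmbedding_addLeft a) (f := f) (s := dom d n)).1 (by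
      exact h1)
  simpa only [Function.comp_def, add_comm a, IntegrableOn] using this


/-- basis vectors -/
def ev {d n : ℕ} (k : Fin d ⊕ Fin n) : Pt d n :=
  Sum.elim (fun i => (Pi.single i 1, 0)) (fun j => (0, Pi.single j 1)) k

/-- directional derivative -/
def D {d n : ℕ} {V : Type*} [NormedAddCommGroup V] [NormedSpace ℝ V]
    (v : Pt d n) (u : Pt d n → V) : Pt d n → V := fun p => fderiv ℝ u p v

section
variable {d n : ℕ} {V : Type*} [NormedAddCommGroup V] [NormedSpace ℝ V]

lemma PerG.shift {B : Type*} {f : Pt d n → B} (h : PerG d n f) (a : Pt d n) :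
    PerG d n (fun x => f (x + a)) := by
  intro j p
  have := h j (p + a)
  simp only at this ⊢
  rw [← this]
  congr 1
  ext <;> simp
  ring

lemma PerG.comp {B C : Type*} {f : Pt d n → B} (h : PerG d n f) (g : B → C) :
    PerG d n (fun x => g (f x)) := fun j p => congrArg g (h j p)

lemma PerG.comp₂ {A B C : Type*} {f : Pt d n → B} (h : PerG d n f) {f' : Pt d n → A}
    (h' : PerG d n f') (g : B → A → C) :
    PerG d n (fun x => g (f x) (f' x)) := fun j p => by
  have h1 := h j p
  have h2 := h' j p
  simp only [h1, h2]

lemma D_per {u : Pt d n → V} (h : PerG d n u) (v : Pt d n) : PerG d n (D v u) := by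
  intro j p
  set a : Pt d n := (0, (2*π) • (Pi.single j 1 : Fin n → ℝ)) with ha
  have e : (p.1, p.2 + (2*π) • (Pi.single j 1 : Fin n → ℝ)) = p + a := by ext <;> simp [ha]
  rw [e]
  unfold D
  rw [← fderiv_comp_add_right]
  have : (fun x => u (x + a)) = u := by
    funext x
    rw [← h j x]
    congr 1
    ext <;> simp [ha]
  rw [this]

lemma D_shift (u : Pt d n → V) (v a : Pt d n) :
    D v (fun x => u (x + a)) = fun x => D v u (x + a) := by
  funext x; unfold D; rw [fderiv_comp_add_right]

lemma D_sub {u w : Pt d n → V} (hu : Differentiable ℝ u) (hw : Differentiable ℝ w) (v : Pt d n) :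
    D v (fun x => u x - w x) = fun x => D v u x - D v w x := by
  funext x; unfold D; rw [fderiv_fun_sub (hu x) (hw x)]; rfl

lemma D_contDiff {u : Pt d n → V} (hu : ContDiff ℝ 2 u) (v : Pt d n) : ContDiff ℝ 1 (D v u) :=
  (hu.fderiv_right (m := 1) (by norm_num)).clm_apply contDiff_const

lemma D_cont {u : Pt d n → V} (hu : ContDiff ℝ 1 u) (v : Pt d n) : Continuous (D v u) :=
  (hu.continuous_fderiv (by norm_num)).clm_apply continuous_const

lemma D_ftc [CompleteSpace V] {u : Pt d n → V} (hu : ContDiff ℝ 1 u) (v x : Pt d n) :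
    ∫ t in (0:ℝ)..1, D v u (x + t • v) = u (x + v) - u x := by
  have := intervalIntegral.integral_eq_sub_of_hasDerivAt (a := 0) (b := 1)
    (f := fun t : ℝ => u (x + t • v)) (f' := fun t => D v u (x + t • v)) (fun t _ => ?_) ?_
  · simpa using this
  · have h1 : HasFDerivAt u (fderiv ℝ u (x + t • v)) (x + t • v) :=
      (hu.differentiable (by norm_num) _).hasFDerivAt
    have h2 : HasDerivAt (fun t : ℝ => x + t • v) v t := by
      simpa using ((hasDerivAt_id t).smul_const v).const_add x
    exact h1.comp_hasDerivAt t h2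
  · exact ((D_cont hu v).comp (by fun_prop)).intervalIntegrable _ _

lemma integral_D_zero [CompleteSpace V] {F : Pt d n → V} (hF : ContDiff ℝ 1 F)
    (hp : PerG d n F) (v : Pt d n)
    (hi : Integrable F (μP d n)) (hDi : Integrable (D v F) (μP d n)) :
    ∫ x, D v F x ∂(μP d n) = 0 := by
  have hDp := D_per hp v
  have h1 : ∫ x, (F (x + v) - F x) ∂(μP d n) = 0 := by
    rw [integral_sub (integrable_trans hp hi v) hi, int_trans hp, sub_self]
  have hI : Integrable (Function.uncurry fun (t : ℝ) (x : Pt d n) => D v F (x + t • v))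
      ((volume.restrict (Ioc (0:ℝ) 1)).prod (μP d n)) := by
    rw [integrable_prod_iff]
    · refine ⟨Eventually.of_forall fun t => integrable_trans hDp hDi (t • v), ?_⟩
      simp only [Function.uncurry_apply_pair]
      have : ∀ t : ℝ, ∫ x, ‖D v F (x + t • v)‖ ∂(μP d n) = ∫ x, ‖D v F x‖ ∂(μP d n) := fun t =>
        int_trans (hDp.comp norm) (t • v)
      simp only [this]
      exact integrable_const _
    · refine Continuous.aestronglyMeasurable ?_
      have := D_cont hF v
      simp only [Function.uncurry_def]
      fun_prop
  have h2 := integral_integral_swap hI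
  have h3 : ∀ t : ℝ, ∫ x, D v F (x + t • v) ∂(μP d n) = ∫ x, D v F x ∂(μP d n) := fun t =>
        int_trans hDp (t • v)
  simp only [h3] at h2
  have h4 : ∀ x, ∫ t in Ioc (0:ℝ) 1, D v F (x + t • v) = F (x + v) - F x := fun x => by
    rw [← D_ftc hF v x, intervalIntegral.integral_of_le zero_le_one]
  simp only [h4, h1] at h2
  simpa using h2
end

/-- working version of H² -/
structure HH (d n : ℕ) (u : Pt d n → ℂ) : Prop where
  cd : ContDiff ℝ 2 u
  per : PerG d n u
  i0 : MemLp u 2 (μP d n)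
  i1 : ∀ k : Fin d ⊕ Fin n, MemLp (D (ev k) u) 2 (μP d n)
  i2 : ∀ k : Fin d ⊕ Fin n, MemLp (D (ev k) (D (ev k) u)) 2 (μP d n)

/-- Laplacian -/
def Lap (d n : ℕ) (u : Pt d n → ℂ) : Pt d n → ℂ :=
  fun p => ∑ k : Fin d ⊕ Fin n, D (ev k) (D (ev k) u) p

lemma lap_eq (d n : ℕ) (u : Pt d n → ℂ) : lap d n u = Lap d n u := by
  funext p
  unfold lap Lap lapX lapY
  rw [Fintype.sum_sum_type]
  rfl

lemma memLp_shift {d n : ℕ} {f : Pt d n → ℂ} (hf : PerG d n f) (hc : Continuous f)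
    (h : MemLp f 2 (μP d n)) (a : Pt d n) : MemLp (fun x => f (x + a)) 2 (μP d n) := by
  rw [memLp_two_iff_integrable_sq_norm (by fun_prop)] at h ⊢
  exact integrable_trans (hf.comp (fun z => ‖z‖^2)) h a

namespace HH
variable {d n : ℕ} {u w : Pt d n → ℂ}

lemma c1 (h : HH d n u) : ContDiff ℝ 1 u := h.cd.of_le (by norm_num)
lemma df (h : HH d n u) : Differentiable ℝ u := h.cd.differentiable (by norm_num)
lemma dD (h : HH d n u) (v) : Differentiable ℝ (D v u) :=
  (D_contDiff h.cd v).differentiable (by norm_num)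
lemma cDD (h : HH d n u) (v v') : Continuous (D v (D v' u)) := D_cont (D_contDiff h.cd v') v
lemma cLap (h : HH d n u) : Continuous (Lap d n u) :=
  continuous_finsetSum _ fun k _ => h.cDD _ _
lemma iLap (h : HH d n u) : MemLp (Lap d n u) 2 (μP d n) :=
  memLp_finsetSum _ fun k _ => h.i2 k
lemma perLap (h : HH d n u) : PerG d n (Lap d n u) := by
  intro j p
  exact Finset.sum_congr rfl fun k _ => D_per (D_per h.per _) _ j p

lemma shift (h : HH d n u) (a : Pt d n) : HH d n (fun x => u (x + a)) where
  cd := h.cd.comp (by fun_prop)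
  per := h.per.shift a
  i0 := memLp_shift h.per h.cd.continuous h.i0 a
  i1 k := by
    rw [D_shift]
    exact memLp_shift (D_per h.per _) (D_cont h.c1 _) (h.i1 k) a
  i2 k := by
    rw [D_shift, D_shift]
    exact memLp_shift (D_per (D_per h.per _) _) (h.cDD _ _) (h.i2 k) a

lemma sub (h : HH d n u) (h' : HH d n w) : HH d n (fun x => u x - w x) where
  cd := h.cd.sub h'.cd
  per := h.per.comp₂ h'.per (fun a b => a - b)
  i0 := h.i0.sub h'.i0
  i1 k := by
    rw [D_sub h.df h'.df]
    exact (h.i1 k).sub (h'.i1 k)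
  i2 k := by
    rw [D_sub h.df h'.df, D_sub (h.dD _) (h'.dD _)]
    exact (h.i2 k).sub (h'.i2 k)

lemma lap_sub (h : HH d n u) (h' : HH d n w) :
    Lap d n (fun x => u x - w x) = fun x => Lap d n u x - Lap d n w x := by
  funext x
  unfold Lap
  rw [← Finset.sum_sub_distrib]
  refine Finset.sum_congr rfl fun k _ => ?_
  rw [D_sub h.df h'.df, D_sub (h.dD _) (h'.dD _)]

lemma lap_shift (u : Pt d n → ℂ) (a : Pt d n) :
    Lap d n (fun x => u (x + a)) = fun x => Lap d n u (x + a) := by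
  funext x
  unfold Lap
  refine Finset.sum_congr rfl fun k _ => ?_
  rw [D_shift, D_shift]

lemma int_inner {f g : Pt d n → ℂ} (hf : MemLp f 2 (μP d n)) (hg : MemLp g 2 (μP d n)) :
    Integrable (fun x => inner ℝ (f x) (g x)) (μP d n) := by
  have h1 := (memLp_two_iff_integrable_sq_norm hf.1).1 hf
  have h2 := (memLp_two_iff_integrable_sq_norm hg.1).1 hg
  refine (h1.add h2).mono' (hf.1.inner hg.1) (Eventually.of_forall fun x => ?_)
  have := norm_inner_le_norm (𝕜 := ℝ) (f x) (g x)
  simp only [Pi.add_apply]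
  nlinarith [sq_nonneg (‖f x‖ - ‖g x‖), sq_nonneg (‖f x‖ + ‖g x‖)]

lemma ibp (h : HH d n u) :
    ∫ x, inner ℝ (u x) (Lap d n u x) ∂(μP d n)
      = -∑ k, ∫ x, ‖D (ev k) u x‖^2 ∂(μP d n) := by
  have key : ∀ k : Fin d ⊕ Fin n, ∫ x, inner ℝ (u x) (D (ev k) (D (ev k) u) x) ∂(μP d n)
      = - ∫ x, ‖D (ev k) u x‖^2 ∂(μP d n) := by
    intro k
    have hD : D (ev k) (fun x => inner ℝ (u x) (D (ev k) u x)) = fun x =>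
        inner ℝ (u x) (D (ev k) (D (ev k) u) x) + ‖D (ev k) u x‖^2 := by
      funext x
      rw [← real_inner_self_eq_norm_sq]
      exact fderiv_inner_apply ℝ (h.df x) (h.dD (ev k) x) (ev k)
    have hi := int_inner h.i0 (h.i2 k)
    have hi' := (memLp_two_iff_integrable_sq_norm (h.i1 k).1).1 (h.i1 k)
    have := integral_D_zero (F := fun x => inner ℝ (u x) (D (ev k) u x))
      (h.c1.inner ℝ (D_contDiff h.cd _)) (h.per.comp₂ (D_per h.per _) (fun a b => inner ℝ a b))
      (ev k) (int_inner h.i0 (h.i1 k)) (by rw [hD]; exact hi.add hi')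
    rw [hD, integral_add hi hi'] at this
    linarith
  unfold Lap
  simp only [inner_sum]
  rw [integral_finsetSum _ fun k _ => int_inner h.i0 (h.i2 k)]
  simp only [key, Finset.sum_neg_distrib]

end HH

/-- coordinates -/
def zc {d n : ℕ} (z : Pt d n) (k : Fin d ⊕ Fin n) : ℝ := Sum.elim z.1 z.2 k

lemma zc_le {d n : ℕ} (z : Pt d n) (k) : |zc z k| ≤ ‖z‖ := by
  rcases k with i | j
  · exact (norm_le_pi_norm z.1 i).trans (norm_fst_le z)
  · exact (norm_le_pi_norm z.2 j).trans (norm_snd_le z)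

lemma zc_sum {d n : ℕ} (z : Pt d n) : z = ∑ k, zc z k • ev k := by
  rw [Fintype.sum_sum_type]
  ext i <;> simp [zc, ev, Prod.fst_sum, Prod.snd_sum, Finset.sum_apply, Pi.single_apply]

lemma D_sq_le {d n : ℕ} (u : Pt d n → ℂ) (z x : Pt d n) :
    ‖D z u x‖^2 ≤ ((d:ℝ)+n) * ‖z‖^2 * ∑ k, ‖D (ev k) u x‖^2 := by
  have h1 : D z u x = ∑ k, zc z k • D (ev k) u x := by
    unfold D
    conv_lhs => rw [zc_sum z]
    rw [map_sum]
    simp only [map_smul]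
  have h2 : ‖D z u x‖ ≤ ∑ k, ‖z‖ * ‖D (ev k) u x‖ := by
    rw [h1]
    refine (norm_sum_le _ _).trans (Finset.sum_le_sum fun k _ => ?_)
    rw [norm_smul]
    exact mul_le_mul_of_nonneg_right (zc_le z k) (norm_nonneg _)
  calc ‖D z u x‖^2 ≤ (∑ k, ‖z‖ * ‖D (ev k) u x‖)^2 := by gcongr
    _ ≤ (Finset.univ : Finset (Fin d ⊕ Fin n)).card * ∑ k, (‖z‖ * ‖D (ev k) u x‖)^2 :=
      sq_sum_le_card_mul_sum_sq
    _ = _ := by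
      simp only [mul_pow, ← Finset.mul_sum]
      simp
      ring

lemma sq_int_le {g : ℝ → ℝ} (hg : Continuous g) :
    (∫ t in (0:ℝ)..1, g t)^2 ≤ ∫ t in (0:ℝ)..1, (g t)^2 := by
  set m := ∫ t in (0:ℝ)..1, g t with hm
  have h0 : 0 ≤ ∫ t in (0:ℝ)..1, (g t - m)^2 :=
    intervalIntegral.integral_nonneg zero_le_one fun t _ => sq_nonneg _
  have h1 : ∫ t in (0:ℝ)..1, (g t - m)^2 = (∫ t in (0:ℝ)..1, (g t)^2) - m^2 := by
    have : ∀ t, (g t - m)^2 = ((g t)^2 - (2*m) * g t) + m^2 := fun t => by ring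
    simp only [this]
    rw [intervalIntegral.integral_add, intervalIntegral.integral_sub,
      intervalIntegral.integral_const_mul, ← hm]
    · simp; ring
    all_goals exact Continuous.intervalIntegrable (by fun_prop) _ _
  linarith

namespace HH
variable {d n : ℕ} {u w : Pt d n → ℂ}

lemma sqi {f : Pt d n → ℂ} (h : MemLp f 2 (μP d n)) : Integrable (fun x => ‖f x‖^2) (μP d n) :=
  (memLp_two_iff_integrable_sq_norm h.1).1 h

lemma quad (h : HH d n u) (b : ℝ) :
    0 ≤ ∫ x, ‖Lap d n u x‖^2 ∂(μP d n) + b * ∑ k, ∫ x, ‖D (ev k) u x‖^2 ∂(μP d n)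
      + b^2/4 * ∫ x, ‖u x‖^2 ∂(μP d n) := by
  have h0 : 0 ≤ ∫ x, ‖Lap d n u x - (b/2) • u x‖^2 ∂(μP d n) :=
    integral_nonneg fun x => by positivity
  have e : ∀ x, ‖Lap d n u x - (b/2) • u x‖^2 =
      (‖Lap d n u x‖^2 - b * inner ℝ (u x) (Lap d n u x)) + b^2/4 * ‖u x‖^2 := fun x => by
    rw [norm_sub_sq_real, real_inner_smul_right, norm_smul, real_inner_comm, mul_pow, norm_eq_abs,
      sq_abs]
    ring
  simp only [e] at h0
  rw [integral_add, integral_sub, integral_const_mul, integral_const_mul, h.ibp] at h0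
  · linarith
  · exact sqi h.iLap
  · exact (int_inner h.i0 h.iLap).const_mul _
  · exact (sqi h.iLap).sub ((int_inner h.i0 h.iLap).const_mul _)
  · exact (sqi h.i0).const_mul _

lemma memD (h : HH d n u) (z : Pt d n) : Integrable (fun x => ‖D z u x‖^2) (μP d n) := by
  refine Integrable.mono' (g := fun x => ((d:ℝ)+n) * ‖z‖^2 * ∑ k, ‖D (ev k) u x‖^2) ?_ ?_ ?_
  · exact (integrable_finsetSum _ fun k _ => sqi (h.i1 k)).const_mul _
  · have := D_cont h.c1 z
    exact Continuous.aestronglyMeasurable (by fun_prop)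
  · refine Eventually.of_forall fun x => ?_
    rw [norm_of_nonneg (by positivity)]
    exact D_sq_le u z x

lemma diff_le (h : HH d n u) (z : Pt d n) :
    ∫ x, ‖u (x + z) - u x‖^2 ∂(μP d n) ≤
      ((d:ℝ)+n) * ‖z‖^2 * ∑ k, ∫ x, ‖D (ev k) u x‖^2 ∂(μP d n) := by
  have hc := D_cont h.c1 z
  have hp : PerG d n (fun x => ‖D z u x‖^2) := (D_per h.per z).comp (fun a => ‖a‖^2)
  have hI : Integrable (Function.uncurry fun (t : ℝ) (x : Pt d n) => ‖D z u (x + t • z)‖^2)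
      ((volume.restrict (Ioc (0:ℝ) 1)).prod (μP d n)) := by
    rw [integrable_prod_iff]
    · refine ⟨Eventually.of_forall fun t => integrable_trans hp (h.memD z) (t • z), ?_⟩
      simp only [Function.uncurry_apply_pair]
      have : ∀ t : ℝ, ∫ x, ‖‖D z u (x + t • z)‖^2‖ ∂(μP d n) = ∫ x, ‖‖D z u x‖^2‖ ∂(μP d n) :=
        fun t => int_trans (hp.comp norm) (t • z)
      simp only [this]
      exact integrable_const _
    · refine Continuous.aestronglyMeasurable ?_
      simp only [Function.uncurry_def]
      fun_prop
  have h1 : ∀ x, ‖u (x + z) - u x‖^2 ≤ ∫ t in Ioc (0:ℝ) 1, ‖D z u (x + t • z)‖^2 := fun x => by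
    rw [← D_ftc h.c1 z x, ← intervalIntegral.integral_of_le zero_le_one]
    refine le_trans ?_ (sq_int_le (g := fun t => ‖D z u (x + t • z)‖) (by fun_prop))
    gcongr
    exact intervalIntegral.norm_integral_le_integral_norm zero_le_one
  calc ∫ x, ‖u (x + z) - u x‖^2 ∂(μP d n)
      ≤ ∫ x, (∫ t in Ioc (0:ℝ) 1, ‖D z u (x + t • z)‖^2) ∂(μP d n) := by
        refine integral_mono (sqi ((h.shift z).sub h).i0) hI.integral_prod_right h1
    _ = ∫ t in Ioc (0:ℝ) 1, ∫ x, ‖D z u (x + t • z)‖^2 ∂(μP d n) := (integral_integral_swap hI).symm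
    _ = ∫ x, ‖D z u x‖^2 ∂(μP d n) := by
        have : ∀ t : ℝ, ∫ x, ‖D z u (x + t • z)‖^2 ∂(μP d n) = ∫ x, ‖D z u x‖^2 ∂(μP d n) :=
          fun t => int_trans hp (t • z)
        simp only [this]
        simp
    _ ≤ ∫ x, ((d:ℝ)+n) * ‖z‖^2 * ∑ k, ‖D (ev k) u x‖^2 ∂(μP d n) := by
        refine integral_mono (h.memD z) ?_ fun x => D_sq_le u z x
        exact (integrable_finsetSum _ fun k _ => sqi (h.i1 k)).const_mul _
    _ = _ := by
        rw [integral_const_mul, integral_finsetSum _ fun k _ => sqi (h.i1 k)]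

/-- second difference -/
def sd (z : Pt d n) (u : Pt d n → ℂ) : Pt d n → ℂ := fun x => u (x + z) + u (x - z) - 2 * u x

lemma sd_le (h : HH d n u) (z : Pt d n) :
    Integrable (fun x => ‖sd z u x‖^2) (μP d n) ∧
    ∫ x, ‖sd z u x‖^2 ∂(μP d n) ≤
      (((d:ℝ)+n) * ‖z‖^2)^2 * ∫ x, ‖Lap d n u x‖^2 ∂(μP d n) := by
  set K := ((d:ℝ)+n) * ‖z‖^2 with hK
  have hK0 : 0 ≤ K := by positivity
  have hw := (h.shift z).sub h
  set w := fun x => u (x + z) - u x with hwd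
  have e : sd z u = fun x => -(w (x + (-z)) - w x) := by
    funext x; simp only [sd, hwd, neg_add_cancel_right, sub_eq_add_neg x z]; ring
  have hsd : MemLp (sd z u) 2 (μP d n) := by
    rw [e]; exact ((hw.shift (-z)).sub hw).i0.neg
  refine ⟨sqi hsd, ?_⟩
  have h1 := hw.diff_le (-z)
  have e2 : ∀ x, ‖w (x + (-z)) - w x‖^2 = ‖sd z u x‖^2 := fun x => by rw [e]; simp only [norm_neg]
  simp only [e2, norm_neg, ← hK] at h1
  have h2 := hw.ibp
  have e3 : Lap d n w = fun x => Lap d n u (x + z) - Lap d n u x := by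
    rw [hwd, lap_sub (h.shift z) h, lap_shift]
  have iz := memLp_shift h.perLap h.cLap h.iLap z
  have e4 : ∫ x, inner ℝ (w x) (Lap d n w x) ∂(μP d n)
      = -∫ x, inner ℝ (sd z u x) (Lap d n u x) ∂(μP d n) := by
    rw [e3]
    simp only [inner_sub_right]
    rw [integral_sub (int_inner hw.i0 iz) (int_inner hw.i0 h.iLap)]
    have := int_trans (f := fun x => inner ℝ (w (x + (-z))) (Lap d n u x))
      ((hw.per.shift (-z)).comp₂ h.perLap (fun a b => inner ℝ a b)) z
    simp only [add_neg_cancel_right] at this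
    rw [this, ← integral_sub (int_inner (hw.shift (-z)).i0 h.iLap) (int_inner hw.i0 h.iLap),
      ← integral_neg]
    congr 1
    funext x
    rw [e]
    simp only [inner_neg_left, inner_sub_left, neg_neg]
  have h3 : K * ∫ x, inner ℝ (sd z u x) (Lap d n u x) ∂(μP d n) ≤
      ∫ x, ((1/2) * ‖sd z u x‖^2 + (K^2/2) * ‖Lap d n u x‖^2) ∂(μP d n) := by
    rw [← integral_const_mul]
    refine integral_mono ((int_inner hsd h.iLap).const_mul _)
      (((sqi hsd).const_mul _).add ((sqi h.iLap).const_mul _)) fun x => ?_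
    have := real_inner_le_norm (sd z u x) (Lap d n u x)
    simp only
    nlinarith [mul_le_mul_of_nonneg_left this hK0, sq_nonneg (‖sd z u x‖ - K * ‖Lap d n u x‖)]
  rw [integral_add ((sqi hsd).const_mul _) ((sqi h.iLap).const_mul _), integral_const_mul,
    integral_const_mul] at h3
  have h4 : ∑ k, ∫ x, ‖D (ev k) w x‖^2 ∂(μP d n) =
    ∫ x, inner ℝ (sd z u x) (Lap d n u x) ∂(μP d n) := by linarith
  rw [h4] at h1
  linarith

end HH

lemma vol_ball (d n : ℕ) {h : ℝ} (hh : 0 ≤ h) :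
    volume (Metric.closedBall (0 : Pt d n) h) = ENNReal.ofReal ((2*h)^(d+n)) := by
  have : Metric.closedBall (0 : Pt d n) h
      = Metric.closedBall (0 : Fin d → ℝ) h ×ˢ Metric.closedBall (0 : Fin n → ℝ) h := by
    rw [closedBall_prod_same]; rfl
  rw [this, Measure.volume_eq_prod, Measure.prod_prod, Real.volume_pi_closedBall _ hh,
    Real.volume_pi_closedBall _ hh, ← ENNReal.ofReal_mul (by positivity)]
  simp [pow_add]

lemma cell {d n : ℕ} {f : Pt d n → ENNReal} (hf : PerG d n f) (x : Pt d n) {h : ℝ} (hh : h < π) :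
    ∫⁻ z in Metric.closedBall (0 : Pt d n) h, f (x + z) ≤ ∫⁻ z, f z ∂(μP d n) := by
  set a : Pt d n := (0, fun _ => π) with ha
  rw [← lintegral_indicator Metric.isClosed_closedBall.measurableSet,
    ← lintegral_add_right_eq_self _ (-a), ← lint_trans hf (x + -a), μP_eq,
    ← lintegral_indicator (measurableSet_dom d n)]
  refine lintegral_mono fun z => ?_
  by_cases hz : z + -a ∈ Metric.closedBall (0 : Pt d n) h
  · have hz' : z ∈ dom d n := by
      refine ⟨mem_univ _, fun j _ => ?_⟩
      rw [mem_closedBall_zero_iff] at hz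
      have h1 := (norm_le_pi_norm (z + -a).2 j).trans ((norm_snd_le (z + -a)).trans hz)
      have h2 : (z + -a).2 j = z.2 j - π := by simp [ha, sub_eq_add_neg]
      rw [h2, norm_eq_abs, abs_le] at h1
      constructor <;> linarith
    rw [indicator_of_mem hz, indicator_of_mem hz']
    apply le_of_eq
    congr 1
    abel
  · rw [indicator_of_notMem hz]; exact zero_le

instance (d : ℕ) : (volume : Measure (Fin d → ℝ)).IsNegInvariant := by
  rw [volume_pi]; infer_instance

instance (d n : ℕ) : (volume : Measure (Pt d n)).IsNegInvariant := by
  constructor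
  have h := (Measure.measurePreserving_neg (volume : Measure (Fin d → ℝ))).prod
    (Measure.measurePreserving_neg (volume : Measure (Fin n → ℝ)))
  exact h.map_eq

lemma cell' {d n : ℕ} {f : Pt d n → ENNReal} (hf : PerG d n f) (x : Pt d n) {h : ℝ} (hh : h < π) :
    ∫⁻ z in Metric.closedBall (0 : Pt d n) h, f (x - z) ≤ ∫⁻ z, f z ∂(μP d n) := by
  refine le_trans (le_of_eq ?_) (cell hf x hh)
  rw [← lintegral_indicator Metric.isClosed_closedBall.measurableSet,
    ← lintegral_indicator Metric.isClosed_closedBall.measurableSet,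
    ← lintegral_neg_eq_self]
  congr 1
  funext z
  by_cases hz : z ∈ Metric.closedBall (0 : Pt d n) h
  · have hz' : -z ∈ Metric.closedBall (0 : Pt d n) h := by
      rw [mem_closedBall_zero_iff] at hz ⊢; rwa [norm_neg]
    rw [indicator_of_mem hz, indicator_of_mem hz', sub_neg_eq_add]
  · have hz' : -z ∉ Metric.closedBall (0 : Pt d n) h := by
      rw [mem_closedBall_zero_iff] at hz ⊢; rwa [norm_neg]
    rw [indicator_of_notMem hz, indicator_of_notMem hz']

namespace HH
variable {d n : ℕ} {u w : Pt d n → ℂ}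

lemma freq (hu : HH d n u) {h : ℝ} (h0 : 0 < h) (hπ : h < π) :
    ∃ g : Pt d n → ENNReal, Measurable g ∧
      (∀ x, 3 * ∫ y, ‖u y‖^2 ∂(μP d n) ≤ ‖u x‖^2 * (2*h)^(d+n) →
        ENNReal.ofReal (‖u x‖^2) ≤ g x) ∧
      ∫⁻ x, g x ∂(μP d n) ≤
        ENNReal.ofReal (3/2 * ((((d:ℝ)+n) * h^2)^2 * ∫ x, ‖Lap d n u x‖^2 ∂(μP d n))) := by
  set c := ∫ y, ‖u y‖^2 ∂(μP d n) with hc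
  set L := ∫ x, ‖Lap d n u x‖^2 ∂(μP d n) with hL
  set V := (2*h)^(d+n) with hV
  have hV0 : 0 < V := by positivity
  have hL0 : 0 ≤ L := integral_nonneg fun x => by positivity
  have hc0 : 0 ≤ c := integral_nonneg fun x => by positivity
  set Q := Metric.closedBall (0 : Pt d n) h with hQ
  have hvol : volume Q = ENNReal.ofReal V := vol_ball d n h0.le
  have hucont := hu.cd.continuous
  have hsdc : Continuous (fun p : Pt d n × Pt d n => ENNReal.ofReal (‖sd p.2 u p.1‖^2)) := by
    unfold sd
    exact ENNReal.continuous_ofReal.comp (by fun_prop)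
  set G : Pt d n → ENNReal := fun x => ∫⁻ z in Q, ENNReal.ofReal (‖sd z u x‖^2) with hG
  have hGm : Measurable G := hsdc.measurable.lintegral_prod_right'
  have hmass : ∫⁻ y, ENNReal.ofReal (‖u y‖^2) ∂(μP d n) = ENNReal.ofReal c := by
    rw [hc, ofReal_integral_eq_lintegral_ofReal (sqi hu.i0)]
    exact Eventually.of_forall fun x => by positivity
  have hper : PerG d n (fun y => ENNReal.ofReal (‖u y‖^2)) := 
    hu.per.comp (fun a => ENNReal.ofReal (‖a‖^2))
  refine ⟨fun x => ENNReal.ofReal (3/2/V) * G x, hGm.const_mul _, ?_, ?_⟩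
  · intro x hx
    have h1 : ∀ z, ENNReal.ofReal (4 * ‖u x‖^2) ≤ ENNReal.ofReal 3 *
        (ENNReal.ofReal (‖u (x + z)‖^2) + ENNReal.ofReal (‖u (x - z)‖^2)
          + ENNReal.ofReal (‖sd z u x‖^2)) := by
      intro z
      rw [← ENNReal.ofReal_add (by positivity) (by positivity),
        ← ENNReal.ofReal_add (by positivity) (by positivity),
        ← ENNReal.ofReal_mul (by positivity)]
      refine ENNReal.ofReal_le_ofReal ?_
      have e : (2:ℂ) * u x = u (x+z) + u (x-z) - sd z u x := by unfold sd; ring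
      have e2 : 2 * ‖u x‖ ≤ ‖u (x+z)‖ + ‖u (x-z)‖ + ‖sd z u x‖ := by
        calc 2 * ‖u x‖ = ‖(2:ℂ) * u x‖ := by simp
          _ ≤ _ := by
            rw [e]
            exact (norm_sub_le _ _).trans (by gcongr; exact norm_add_le _ _)
      have e3 : (2 * ‖u x‖)^2 ≤ (‖u (x+z)‖ + ‖u (x-z)‖ + ‖sd z u x‖)^2 := by gcongr
      nlinarith [sq_nonneg (‖u (x+z)‖ - ‖u (x-z)‖), sq_nonneg (‖u (x+z)‖ - ‖sd z u x‖),
        sq_nonneg (‖sd z u x‖ - ‖u (x-z)‖)]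
    have h2 : ENNReal.ofReal (4 * ‖u x‖^2) * ENNReal.ofReal V ≤
        ENNReal.ofReal 3 * (ENNReal.ofReal c + ENNReal.ofReal c + G x) := by
      calc ENNReal.ofReal (4 * ‖u x‖^2) * ENNReal.ofReal V
          = ∫⁻ z in Q, ENNReal.ofReal (4 * ‖u x‖^2) := by
            rw [setLIntegral_const, hvol]
        _ ≤ ∫⁻ z in Q, ENNReal.ofReal 3 *
        (ENNReal.ofReal (‖u (x + z)‖^2) + ENNReal.ofReal (‖u (x - z)‖^2)
          + ENNReal.ofReal (‖sd z u x‖^2)) := lintegral_mono h1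
        _ = ENNReal.ofReal 3 * ((∫⁻ z in Q, ENNReal.ofReal (‖u (x + z)‖^2)) +
            (∫⁻ z in Q, ENNReal.ofReal (‖u (x - z)‖^2)) + G x) := by
            have m1 : Measurable fun z : Pt d n => ENNReal.ofReal (‖u (x + z)‖^2) :=
              ENNReal.measurable_ofReal.comp (Continuous.measurable (by fun_prop))
            have m2 : Measurable fun z : Pt d n => ENNReal.ofReal (‖u (x - z)‖^2) :=
              ENNReal.measurable_ofReal.comp (Continuous.measurable (by fun_prop))
            rw [lintegral_const_mul' _ _ ENNReal.ofReal_ne_top,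
              lintegral_add_left (by exact m1.add m2), lintegral_add_left m1]
        _ ≤ _ := by
            gcongr
            · exact (cell hper x hπ).trans hmass.le
            · exact (cell' hper x hπ).trans hmass.le
    by_cases hGt : G x = ⊤
    · have : ENNReal.ofReal (3/2/V) ≠ 0 := by
        rw [Ne, ENNReal.ofReal_eq_zero, not_le]; positivity
      simp only [hGt, ENNReal.mul_top this, le_top]
    · obtain ⟨y, hy0, hy⟩ : ∃ y : ℝ, 0 ≤ y ∧ G x = ENNReal.ofReal y :=
        ⟨(G x).toReal, ENNReal.toReal_nonneg, (ENNReal.ofReal_toReal hGt).symm⟩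
      simp only [hy] at h2 ⊢
      rw [← ENNReal.ofReal_add hc0 hc0, ← ENNReal.ofReal_add (by positivity) hy0,
        ← ENNReal.ofReal_mul (by positivity), ← ENNReal.ofReal_mul (by positivity),
        ENNReal.ofReal_le_ofReal_iff (by positivity)] at h2
      rw [← ENNReal.ofReal_mul (by positivity)]
      refine ENNReal.ofReal_le_ofReal ?_
      rw [div_div, div_mul_eq_mul_div, le_div_iff₀ (by positivity)]
      nlinarith
  · rw [lintegral_const_mul _ hGm]
    have h3 : ∫⁻ x, G x ∂(μP d n) ≤ ENNReal.ofReal ((((d:ℝ)+n) * h^2)^2 * L) * ENNReal.ofReal V := by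
      rw [hG, lintegral_lintegral_swap hsdc.measurable.aemeasurable, ← hvol, ← setLIntegral_const]
      refine setLIntegral_mono' Metric.isClosed_closedBall.measurableSet fun z hz => ?_
      rw [mem_closedBall_zero_iff] at hz
      have := hu.sd_le z
      rw [← ofReal_integral_eq_lintegral_ofReal this.1 (Eventually.of_forall fun x => by positivity)]
      refine ENNReal.ofReal_le_ofReal (this.2.trans ?_)
      gcongr
    refine (mul_le_mul_right h3 _).trans (le_of_eq ?_)
    rw [← ENNReal.ofReal_mul (by positivity), ← ENNReal.ofReal_mul (by positivity)]
    congr 1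
    field_simp

end HH

lemma GN (d n : ℕ) (hdn : 1 ≤ d + n) {α c ε : ℝ} (hα : 0 < α) (hα' : α < 8 / ((d:ℝ)+n))
    (hc : 0 < c) (hε : 0 < ε) :
    ∃ C : ℝ, ∀ u, HH d n u → ∫ x, ‖u x‖^2 ∂(μP d n) = c →
      ∫ x, ‖u x‖^(α+2) ∂(μP d n) ≤ ε * ∫ x, ‖Lap d n u x‖^2 ∂(μP d n) + C := by
  have hN : (0:ℝ) < (d:ℝ) + n := by exact_mod_cast hdn
  set N := d + n with hNdef
  have hNc : ((d:ℝ) + n) = (N:ℝ) := by push_cast [hNdef]; rfl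
  set b : ℝ := 2^N with hb
  have hb0 : 0 < b := by positivity
  have hb1 : 1 < b := one_lt_pow₀ (by norm_num) (by omega)
  set r : ℝ := b^(α/2) / 16 with hr
  have hr0 : 0 < r := by positivity
  have hr1 : r < 1 := by
    rw [hr, div_lt_one (by norm_num), hb, ← Real.rpow_natCast, ← Real.rpow_mul (by norm_num)]
    have : (16:ℝ) = 2^(4:ℝ) := by norm_num
    rw [this]
    apply Real.rpow_lt_rpow_of_exponent_lt (by norm_num)
    rw [lt_div_iff₀ hN, hNc] at hα'
    linarith
  set A : ℝ := (3*c*b)^(α/2) * (3/2 * (((d:ℝ)+n)^2/16)) with hA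
  have hA0 : 0 < A := by positivity
  obtain ⟨K, hK⟩ : ∃ K : ℕ, A * r^K / (1 - r) ≤ ε := by
    have h1 : Tendsto (fun K : ℕ => A * r^K / (1 - r)) atTop (nhds (A * 0 / (1 - r))) :=
      ((tendsto_pow_atTop_nhds_zero_of_lt_one hr0.le hr1).const_mul A).div_const _
    have h2 : A * 0 / (1 - r) < ε := by simpa using hε
    obtain ⟨K, hK⟩ := (h1.eventually (gt_mem_nhds h2)).exists
    exact ⟨K, hK.le⟩
  refine ⟨(3*c*b^K)^(α/2) * c, fun u hu huc => ?_⟩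
  set L := ∫ x, ‖Lap d n u x‖^2 ∂(μP d n) with hL
  have hL0 : 0 ≤ L := integral_nonneg fun x => by positivity
  have hh0 : ∀ k : ℕ, (0:ℝ) < (1/2)^k/2 := fun k => by positivity
  have hhπ : ∀ k : ℕ, ((1/2)^k/2 : ℝ) < π := fun k => by
    have : ((1/2)^k : ℝ) ≤ 1 := pow_le_one₀ (by norm_num) (by norm_num)
    linarith [Real.pi_gt_three]
  choose g hgm hg1 hg2 using fun k : ℕ => hu.freq (hh0 k) (hhπ k)
  rw [huc] at hg1
  have hpow : ∀ x, ‖u x‖^(α+2) = ‖u x‖^2 * (‖u x‖^2)^(α/2) := fun x => by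
    have h1 : (‖u x‖^2)^(α/2) = ‖u x‖^α := by
      rw [← Real.rpow_natCast, ← Real.rpow_mul (norm_nonneg _)]
      congr 1; push_cast; ring
    rw [h1, Real.rpow_add' (norm_nonneg _) (by positivity), mul_comm]
    congr 1
    exact_mod_cast Real.rpow_natCast _ 2
  have hpt : ∀ x, ENNReal.ofReal (‖u x‖^(α+2)) ≤
      ENNReal.ofReal ((3*c*b^K)^(α/2)) * ENNReal.ofReal (‖u x‖^2)
        + ∑' k : ℕ, ENNReal.ofReal ((3*c*b^(K+k+1))^(α/2)) * g (K+k) x := by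
    intro x
    rcases le_or_gt (‖u x‖^2) (3*c*b^K) with hx | hx
    · refine le_trans ?_ le_self_add
      rw [← ENNReal.ofReal_mul (by positivity), hpow, mul_comm]
      refine ENNReal.ofReal_le_ofReal ?_
      gcongr
    · refine le_trans ?_ le_add_self
      have hy : b^K < ‖u x‖^2 / (3*c) := by
        rw [lt_div_iff₀ (by positivity)]; linarith
      obtain ⟨m, hm1, hm2⟩ := exists_nat_pow_near
        ((one_le_pow₀ hb1.le).trans hy.le) hb1
      have hKm : K ≤ m := by
        have := (pow_lt_pow_iff_right₀ hb1).1 (hy.trans hm2)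
        omega
      obtain ⟨k, rfl⟩ := Nat.exists_eq_add_of_le hKm
      refine le_trans ?_ (ENNReal.le_tsum k)
      rw [le_div_iff₀ (by positivity)] at hm1
      rw [div_lt_iff₀ (by positivity)] at hm2
      have hgx := hg1 (K+k) x (by
        have e : (2 * ((1/2)^(K+k)/2) : ℝ)^(d+n) = (b^(K+k))⁻¹ := by
          rw [hb, ← pow_mul, ← hNdef, mul_div_cancel₀ _ (by norm_num), ← pow_mul, one_div,
            inv_pow, mul_comm]
        rw [e, ← div_eq_mul_inv, le_div_iff₀ (by positivity)]
        linarith)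
      rw [hpow, mul_comm, ENNReal.ofReal_mul (by positivity)]
      refine mul_le_mul' (ENNReal.ofReal_le_ofReal ?_) hgx
      refine Real.rpow_le_rpow (by positivity) ?_ (by positivity)
      linarith
  have hmass : ∫⁻ y, ENNReal.ofReal (‖u y‖^2) ∂(μP d n) = ENNReal.ofReal c := by
    rw [← huc, ofReal_integral_eq_lintegral_ofReal (HH.sqi hu.i0)]
    exact Eventually.of_forall fun x => by positivity
  have hterm : ∀ k : ℕ, ENNReal.ofReal ((3*c*b^(K+k+1))^(α/2)) * ∫⁻ x, g (K+k) x ∂(μP d n)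
      ≤ ENNReal.ofReal (A * L * r^K * r^k) := by
    intro k
    refine (mul_le_mul_right (hg2 (K+k)) _).trans ?_
    rw [← ENNReal.ofReal_mul (by positivity)]
    refine ENNReal.ofReal_le_ofReal (le_of_eq ?_)
    have e1 : (3*c*b^(K+k+1))^(α/2) = (3*c*b)^(α/2) * (b^(α/2))^(K+k) := by
      rw [pow_succ, show 3*c*(b^(K+k)*b) = (3*c*b)*b^(K+k) by ring,
        Real.mul_rpow (by positivity) (by positivity)]
      congr 1
      rw [← Real.rpow_natCast, ← Real.rpow_natCast, ← Real.rpow_mul hb0.le, ← Real.rpow_mul hb0.le,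
        mul_comm]
    have e2 : r^K * r^k = (b^(α/2))^(K+k) * ((1/2)^(K+k))^4 := by
      rw [← pow_add, hr, div_pow, ← pow_mul, mul_comm (K+k) 4, pow_mul]
      rw [show ((1/2:ℝ)^4) = (16:ℝ)⁻¹ by norm_num, inv_pow, div_eq_mul_inv]
    rw [e1, mul_assoc (A*L), e2, hA]
    ring
  have hbound : ∫⁻ x, ENNReal.ofReal (‖u x‖^(α+2)) ∂(μP d n) ≤
      ENNReal.ofReal (ε * L + (3*c*b^K)^(α/2) * c) := by
    refine (lintegral_mono hpt).trans ?_
    have m1 : Measurable fun x => ENNReal.ofReal ((3*c*b^K)^(α/2)) * ENNReal.ofReal (‖u x‖^2) := by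
      have := hu.cd.continuous
      exact (ENNReal.measurable_ofReal.comp (Continuous.measurable (by fun_prop))).const_mul _
    rw [lintegral_add_left m1, lintegral_const_mul' _ _ ENNReal.ofReal_ne_top, hmass,
      lintegral_tsum fun k => ((hgm _).const_mul _).aemeasurable, add_comm,
      ENNReal.ofReal_add (by positivity) (by positivity), ← ENNReal.ofReal_mul (by positivity)]
    gcongr
    simp only [lintegral_const_mul' _ _ ENNReal.ofReal_ne_top]
    refine (ENNReal.tsum_le_tsum hterm).trans ?_
    have hs : Summable fun k : ℕ => A * L * r^K * r^k :=
      (summable_geometric_of_lt_one hr0.le hr1).mul_left _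
    rw [← ENNReal.ofReal_tsum_of_nonneg (fun k => by positivity) hs, tsum_mul_left,
      tsum_geometric_of_lt_one hr0.le hr1]
    refine ENNReal.ofReal_le_ofReal ?_
    calc A * L * r^K * (1-r)⁻¹ = (A * r^K / (1-r)) * L := by rw [div_eq_mul_inv]; ring
      _ ≤ ε * L := by gcongr
  rw [integral_eq_lintegral_of_nonneg_ae (Eventually.of_forall fun x => by positivity)]
  · refine ENNReal.toReal_le_of_le_ofReal (by positivity) hbound
  · have := hu.cd.continuous
    exact (this.norm.rpow_const fun x => Or.inr (by positivity)).aestronglyMeasurable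

section
variable {d n : ℕ} {u : Pt d n → ℂ}

lemma hessInt_eq (u : Pt d n → ℂ) (z : Pt d n) :
    hessInt d n u z = ∑ k : Fin d ⊕ Fin n, ∑ l : Fin d ⊕ Fin n, ‖D (ev k) (D (ev l) u) z‖^2 := by
  have h2 : ∑ i, ∑ j, ‖dY d n j (dX d n i u) z‖^2 = ∑ j, ∑ i, ‖dY d n j (dX d n i u) z‖^2 :=
    Finset.sum_comm
  have h3 : ∑ j, ∑ i, ‖dX d n i (dY d n j u) z‖^2 = ∑ i, ∑ j, ‖dX d n i (dY d n j u) z‖^2 :=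
    Finset.sum_comm
  simp only [hessInt, h2, h3, Fintype.sum_sum_type, Finset.sum_add_distrib]
  change _ = (∑ i, ∑ i', ‖dX d n i (dX d n i' u) z‖^2) + (∑ j, ∑ i, ‖dY d n j (dX d n i u) z‖^2)
    + ((∑ i, ∑ j, ‖dX d n i (dY d n j u) z‖^2) + (∑ j, ∑ j', ‖dY d n j (dY d n j' u) z‖^2))
  ring

lemma gradInt_eq (u : Pt d n → ℂ) (z : Pt d n) :
    (∑ i, ‖dX d n i u z‖^2) + ∑ j, ‖dY d n j u z‖^2 = ∑ k : Fin d ⊕ Fin n, ‖D (ev k) u z‖^2 := by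
  rw [Fintype.sum_sum_type]; rfl

lemma InH2.hh (h : InH2 d n u) : HH d n u := by
  obtain ⟨cd, per, i0, i1, i2⟩ := h
  have c1 : ContDiff ℝ 1 u := cd.of_le (by norm_num)
  simp only [gradInt_eq] at i1
  refine ⟨cd, per, ?_, fun k => ?_, fun k => ?_⟩
  · exact (memLp_two_iff_integrable_sq_norm cd.continuous.aestronglyMeasurable).2 i0
  · have := D_cont c1 (ev k)
    refine (memLp_two_iff_integrable_sq_norm this.aestronglyMeasurable).2 ?_
    refine i1.mono' (Continuous.aestronglyMeasurable (by fun_prop)) (Eventually.of_forall fun x => ?_)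
    rw [norm_of_nonneg (by positivity)]
    exact Finset.single_le_sum (f := fun k => ‖D (ev k) u x‖^2) (fun _ _ => by positivity)
      (Finset.mem_univ k)
  · have := D_cont (D_contDiff cd (ev k)) (ev k)
    refine (memLp_two_iff_integrable_sq_norm this.aestronglyMeasurable).2 ?_
    refine i2.mono' (Continuous.aestronglyMeasurable (by fun_prop)) (Eventually.of_forall fun x => ?_)
    rw [norm_of_nonneg (by positivity), hessInt_eq]
    refine (Finset.single_le_sum (f := fun l => ‖D (ev k) (D (ev l) u) x‖^2)
      (fun _ _ => by positivity) (Finset.mem_univ k)).trans ?_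
    exact Finset.single_le_sum (f := fun k => ∑ l, ‖D (ev k) (D (ev l) u) x‖^2)
      (fun _ _ => by positivity) (Finset.mem_univ k)

lemma lapSq_eq (u : Pt d n → ℂ) : lapSq d n u = ∫ x, ‖Lap d n u x‖^2 ∂(μP d n) := by
  unfold lapSq; rw [lap_eq]

lemma gradSq_eq (h : HH d n u) : gradSq d n u = ∑ k, ∫ x, ‖D (ev k) u x‖^2 ∂(μP d n) := by
  unfold gradSq gradXSq gradYSq
  rw [Fintype.sum_sum_type, ← integral_finsetSum _ fun k _ => HH.sqi (h.i1 (Sum.inl k)),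
    ← integral_finsetSum _ fun k _ => HH.sqi (h.i1 (Sum.inr k))]
  rfl

lemma quad' (h : InH2 d n u) (b : ℝ) :
    0 ≤ lapSq d n u + b * gradSq d n u + b^2/4 * Mass d n u := by
  rw [lapSq_eq, gradSq_eq h.hh]
  exact h.hh.quad b

lemma lapSq_nonneg : 0 ≤ lapSq d n u := integral_nonneg fun x => by positivity
lemma Npow_nonneg (p : ℝ) : 0 ≤ Npow d n p u := integral_nonneg fun x => by positivity

lemma coercive (d n : ℕ) (hdn : 1 ≤ d + n) {α c : ℝ} (β : ℝ) (hα : 0 < α)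
    (hα' : α < 8 / ((d:ℝ)+n)) (hc : 0 < c) :
    ∃ B : ℝ, ∀ u ∈ Sset d n c, lapSq d n u ≤ 8 * En d n β α u + B ∧
      Npow d n (α+2) u ≤ (α+2) * En d n β α u + B := by
  obtain ⟨C, hC⟩ := GN d n hdn (ε := (α+2)/8) hα hα' hc (by positivity)
  refine ⟨max (8 * (β^2*c/4 + C/(α+2))) ((α+2)/8 * (8 * (β^2*c/4 + C/(α+2))) + C),
    fun u hu => ?_⟩
  have h1 : Npow d n (α+2) u ≤ (α+2)/8 * lapSq d n u + C := by
    rw [lapSq_eq]; exact hC u hu.1.hh hu.2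
  have h2 := quad' hu.1 (2*β)
  rw [hu.2] at h2
  have h3 : 1/(α+2) * Npow d n (α+2) u ≤ 1/8 * lapSq d n u + C/(α+2) := by
    rw [one_div, inv_mul_le_iff₀ (by positivity)]
    refine h1.trans (le_of_eq ?_)
    field_simp
  have h4 : lapSq d n u ≤ 8 * En d n β α u + 8 * (β^2*c/4 + C/(α+2)) := by
    unfold En; nlinarith
  refine ⟨h4.trans (by gcongr; exact le_max_left _ _), ?_⟩
  refine le_trans (h1.trans ?_) (add_le_add_right (le_max_right _ _) _)
  have : (α+2)/8 * lapSq d n u ≤ (α+2)/8 * (8 * En d n β α u + 8 * (β^2*c/4 + C/(α+2))) := by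
    gcongr
  linarith

lemma bdd (d n : ℕ) (hdn : 1 ≤ d + n) {α c : ℝ} (β : ℝ) (hα : 0 < α)
    (hα' : α < 8 / ((d:ℝ)+n)) (hc : 0 < c) : BddBelow (En d n β α '' Sset d n c) := by
  obtain ⟨B, hB⟩ := coercive d n hdn β hα hα' hc
  refine ⟨-B/8, ?_⟩
  rintro _ ⟨u, hu, rfl⟩
  have := (hB u hu).1
  have := lapSq_nonneg (u := u)
  linarith

/-! scaling -/
lemma D_smul (s : ℝ) (u : Pt d n → ℂ) (v : Pt d n) :
    D v (fun x => s • u x) = fun x => s • D v u x := by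
  funext x; unfold D
  have := congrFun (fderiv_const_smul_field (𝕜 := ℝ) (f := u) s) x
  change (fderiv ℝ (s • u) x) v = _
  rw [this]; rfl

lemma dX_smul (s : ℝ) (u : Pt d n → ℂ) (i) :
    dX d n i (fun x => s • u x) = fun x => s • dX d n i u x := D_smul s u _
lemma dY_smul (s : ℝ) (u : Pt d n → ℂ) (i) :
    dY d n i (fun x => s • u x) = fun x => s • dY d n i u x := D_smul s u _

lemma nsq (s : ℝ) (a : ℂ) : ‖s • a‖^2 = s^2 * ‖a‖^2 := by
  rw [norm_smul, mul_pow, norm_eq_abs, sq_abs]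

lemma InH2.smul (h : InH2 d n u) (s : ℝ) : InH2 d n (fun x => s • u x) := by
  obtain ⟨cd, per, i0, i1, i2⟩ := h
  refine ⟨by exact cd.const_smul s, fun j p => ?_, ?_, ?_, ?_⟩
  · simp only [per j p]
  · simp only [nsq]; exact i0.const_mul _
  · simp only [gradInt_eq] at i1 ⊢
    simp only [D_smul, nsq, ← Finset.mul_sum]; exact i1.const_mul _
  · have : ∀ z, hessInt d n (fun x => s • u x) z = s^2 * hessInt d n u z := fun z => by
      simp only [hessInt_eq, D_smul, nsq, ← Finset.mul_sum]
    exact (i2.const_mul (s^2)).congr (Eventually.of_forall fun z => (this z).symm)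

lemma mass_smul (s : ℝ) : Mass d n (fun x => s • u x) = s^2 * Mass d n u := by
  unfold Mass; simp only [nsq]; rw [integral_const_mul]

lemma lapSq_smul (s : ℝ) : lapSq d n (fun x => s • u x) = s^2 * lapSq d n u := by
  simp only [lapSq_eq, Lap, D_smul, ← Finset.smul_sum, nsq]; rw [integral_const_mul]

lemma gradSq_smul (s : ℝ) : gradSq d n (fun x => s • u x) = s^2 * gradSq d n u := by
  simp only [gradSq, gradXSq, gradYSq, dX_smul, dY_smul, nsq, ← Finset.mul_sum]
  rw [integral_const_mul, integral_const_mul]; ring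

lemma Npow_smul {s : ℝ} (hs : 0 ≤ s) (p : ℝ) :
    Npow d n p (fun x => s • u x) = s^p * Npow d n p u := by
  unfold Npow
  rw [← integral_const_mul]
  congr 1
  funext x
  rw [norm_smul, norm_of_nonneg hs, Real.mul_rpow hs (norm_nonneg _)]

lemma En_smul {s : ℝ} (hs : 0 < s) (β α : ℝ) :
    En d n β α (fun x => s • u x) = s^2 * (1/2 * lapSq d n u + β/2 * gradSq d n u
      - s^α * (1/(α+2) * Npow d n (α+2) u)) := by
  have : s^(α+2) = s^2 * s^α := by
    rw [Real.rpow_add hs, mul_comm]; norm_num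
  rw [En, lapSq_smul, gradSq_smul, Npow_smul hs.le, this]; ring

/-! test function -/
lemma D_zero {K : Set (Fin d → ℝ)} (hK : IsClosed K) {V : Type*} [NormedAddCommGroup V]
    [NormedSpace ℝ V] {u : Pt d n → V} (h : ∀ p, p.1 ∉ K → u p = 0) (v : Pt d n) :
    ∀ p, p.1 ∉ K → D v u p = 0 := by
  intro p hp
  have : u =ᶠ[nhds p] fun _ => 0 := by
    have ho : IsOpen ((Prod.fst : Pt d n → _) ⁻¹' Kᶜ) := hK.isOpen_compl.preimage continuous_fst
    filter_upwards [ho.mem_nhds hp] with q hq using h q hq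
  unfold D
  rw [this.fderiv_eq]
  simp

lemma integ {K : Set (Fin d → ℝ)} (hK : IsCompact K) {g : Pt d n → ℝ} (hg : Continuous g)
    (h : ∀ p, p.1 ∉ K → g p = 0) : Integrable g (μP d n) := by
  rw [μP_eq]
  have hc : IsCompact (K ×ˢ (Set.univ.pi fun _ : Fin n => Set.Icc 0 (2*π))) :=
    hK.prod (isCompact_univ_pi fun _ => isCompact_Icc)
  have h1 : IntegrableOn g (K ×ˢ (Set.univ.pi fun _ : Fin n => Set.Icc 0 (2*π))) volume :=
    hg.continuousOn.integrableOn_compact hc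
  refine h1.of_forall_sdiff_eq_zero (measurableSet_dom d n) ?_
  rintro p ⟨hp1, hp2⟩
  apply h
  intro hpK
  exact hp2 ⟨hpK, fun j hj => Ico_subset_Icc_self (hp1.2 j hj)⟩

lemma exists_test (d n : ℕ) : ∃ u : Pt d n → ℂ, InH2 d n u ∧ 0 < Mass d n u ∧
    ∀ p : ℝ, 0 < p → 0 < Npow d n p u := by
  let f : ContDiffBump (0 : Fin d → ℝ) := ⟨1, 2, by norm_num, by norm_num⟩
  have hfs : ContDiff ℝ 2 f := f.contDiff
  set K := tsupport f with hKd
  have hK : IsCompact K := f.hasCompactSupport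
  have hKc : IsClosed K := isClosed_tsupport _
  let u : Pt d n → ℂ := fun p => ((f p.1 : ℝ) : ℂ)
  have hu : ContDiff ℝ 2 u := Complex.ofRealCLM.contDiff.comp (hfs.comp contDiff_fst)
  have hu1 : ContDiff ℝ 1 u := hu.of_le (by norm_num)
  have hz : ∀ p, p.1 ∉ K → u p = 0 := fun p hp => by
    simp [u, image_eq_zero_of_notMem_tsupport hp]
  have hN : ∀ p : ℝ, 0 < p → 0 < Npow d n p u := by
    intro p hp
    have : SFinite (μT n) := by unfold μT; infer_instance
    have e : Npow d n p u = (μT n).real univ * ∫ x, (f x)^p := by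
      unfold Npow μP
      have := integral_fun_fst (μ := (volume : Measure (Fin d → ℝ))) (ν := μT n)
        (fun x => (f x)^p)
      rw [smul_eq_mul] at this
      rw [← this]
      congr 1
      funext z
      simp only [u, Complex.norm_real, norm_of_nonneg (f.nonneg' _)]
    rw [e]
    refine mul_pos ?_ ?_
    · have h2 : (0:ℝ) ≤ 2 * π := by positivity
      have : (μT n).real univ = (2*π)^n := by
        simp only [Measure.real, μT, torusBox, Measure.restrict_apply_univ,
          volume_pi_pi, Real.volume_Ico, sub_zero, Finset.prod_const, ENNReal.toReal_pow,
          ENNReal.toReal_ofReal h2]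
        simp
      rw [this]
      positivity
    · have hfc : Continuous fun x => (f x)^p := f.continuous.rpow_const fun _ => Or.inr hp.le
      refine hfc.integral_pos_of_hasCompactSupport_nonneg_nonzero (x := 0) ?_ ?_ ?_
      · exact f.hasCompactSupport.comp_left (g := fun y : ℝ => y^p) (Real.zero_rpow hp.ne')
      · exact fun x => Real.rpow_nonneg (f.nonneg' _) _
      · have : f 0 = 1 := f.one_of_mem_closedBall (by simp [f])
        simp [this]
  refine ⟨u, ⟨hu, fun j p => rfl, ?_, ?_, ?_⟩, ?_, hN⟩
  · refine integ hK (by have := hu.continuous; fun_prop) fun p hp => by simp [hz p hp]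
  · simp only [gradInt_eq]
    refine integ hK (continuous_finsetSum _ fun k _ => ?_) fun p hp => ?_
    · have := D_cont hu1 (ev k); fun_prop
    · exact Finset.sum_eq_zero fun k _ => by simp [D_zero hKc hz (ev k) p hp]
  · refine (integrable_congr (Eventually.of_forall fun z => hessInt_eq u z)).2 ?_
    refine integ hK (continuous_finsetSum _ fun k _ => continuous_finsetSum _ fun l _ => ?_)
      fun p hp => ?_
    · have := D_cont (D_contDiff hu (ev l)) (ev k); fun_prop
    · refine Finset.sum_eq_zero fun k _ => Finset.sum_eq_zero fun l _ => ?_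
      simp [D_zero hKc (D_zero hKc hz (ev l)) (ev k) p hp]
  · have := hN 2 (by norm_num)
    unfold Npow at this
    unfold Mass
    simpa using this

lemma set_nonempty (d n : ℕ) (hdn : 1 ≤ d + n) {α : ℝ} (β : ℝ) (hα : 0 < α)
    (hα' : α < 8 / ((d:ℝ)+n)) : {c' : ℝ | 0 < c' ∧ mC d n β α c' < -β^2 * c' / 8}.Nonempty := by
  obtain ⟨u, hu, hm, hN⟩ := exists_test d n
  have hN := hN (α+2) (by positivity)
  set P := 1/(α+2) * Npow d n (α+2) u with hP
  have hP0 : 0 < P := by positivity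
  set T := 1/2 * lapSq d n u + β/2 * gradSq d n u + β^2 * Mass d n u / 8 with hT
  obtain ⟨s, hs1, hs2⟩ : ∃ s : ℝ, T / P < s^α ∧ 0 < s :=
    (((tendsto_rpow_atTop hα).eventually_gt_atTop (T/P)).and (eventually_gt_atTop 0)).exists
  rw [div_lt_iff₀ hP0] at hs1
  have hc : 0 < s^2 * Mass d n u := by positivity
  refine ⟨s^2 * Mass d n u, hc, ?_⟩
  have hmem : (fun x => s • u x) ∈ Sset d n (s^2 * Mass d n u) := ⟨hu.smul s, mass_smul s⟩
  refine (csInf_le (bdd d n hdn β hα hα' hc) ⟨_, hmem, rfl⟩).trans_lt ?_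
  rw [En_smul hs2, ← hP]
  have : s^2 * (T - s^α * P) < 0 := mul_neg_of_pos_of_neg (by positivity) (by linarith)
  rw [hT] at this
  linarith

lemma below (d n : ℕ) (hdn : 1 ≤ d + n) {α c : ℝ} (β : ℝ) (hβ : β < 0) (hα : 0 < α)
    (hα' : α < 8 / ((d:ℝ)+n)) (hc : 0 < c)
    (hcm : sInf {c' : ℝ | 0 < c' ∧ mC d n β α c' < -β^2 * c' / 8} < c) :
    mC d n β α c < -β^2 * c / 8 := by
  obtain ⟨c', ⟨hc'0, hc'⟩, hlt⟩ := exists_lt_of_csInf_lt (set_nonempty d n hdn β hα hα') hcm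
  have hne : (En d n β α '' Sset d n c').Nonempty := by
    by_contra h
    rw [Set.not_nonempty_iff_eq_empty] at h
    rw [mC, h, Real.sInf_empty] at hc'
    have : 0 < β^2 * c' := by have := hβ.ne; positivity
    linarith
  obtain ⟨_, ⟨u, hu, rfl⟩, hE⟩ := exists_lt_of_csInf_lt hne hc'
  set s := √(c/c') with hs
  have hs2 : s^2 = c/c' := Real.sq_sqrt (by positivity)
  have hs1 : 1 ≤ s := by
    rw [hs, Real.one_le_sqrt, one_le_div hc'0]; exact hlt.le
  have hs0 : 0 < s := by linarith
  have hmem : (fun x => s • u x) ∈ Sset d n c :=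
    ⟨hu.1.smul s, by rw [mass_smul, hu.2, hs2]; field_simp⟩
  refine (csInf_le (bdd d n hdn β hα hα' hc) ⟨_, hmem, rfl⟩).trans_lt ?_
  rw [En_smul hs0]
  have h1 : 1 ≤ s^α := Real.one_le_rpow hs1 hα.le
  have h2 : 0 ≤ 1/(α+2) * Npow d n (α+2) u := mul_nonneg (by positivity) (Npow_nonneg _)
  have h3 : 1/2 * lapSq d n u + β/2 * gradSq d n u - s^α * (1/(α+2) * Npow d n (α+2) u)
      < -β^2 * c' / 8 := by
    unfold En at hE
    nlinarith
  have h4 := mul_lt_mul_of_pos_left h3 (show 0 < s^2 by positivity)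
  refine h4.trans_le (le_of_eq ?_)
  rw [hs2]; field_simp
end

end BNLS

open BNLS in
/-- lower bound for `liminf ‖u_n‖_{α+2}^{α+2}` along minimizing sequences. -/
theorem stmt_10 (d n : ℕ) (hd : 1 ≤ d) (hn : 1 ≤ n) (β α c : ℝ)
    (hβ : β < 0) (hα : 0 < α) (hα' : α < 8 / ((d:ℝ)+n)) (hc : 0 < c)
    (hcm : sInf {c' : ℝ | 0 < c' ∧ mC d n β α c' < -β^2 * c' / 8} < c)
    (u : ℕ → Pt d n → ℂ) (hu : ∀ k, u k ∈ Sset d n c)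
    (hmin : Tendsto (fun k => En d n β α (u k)) atTop (nhds (mC d n β α c))) :
    c * (α+2) * (-(mC d n β α c) / c - β^2/8)
        ≤ Filter.liminf (fun k => Npow d n (α+2) (u k)) atTop ∧
    0 < c * (α+2) * (-(mC d n β α c) / c - β^2/8) := by
  have hdn : 1 ≤ d + n := by omega
  have hb := below d n hdn β hβ hα hα' hc hcm
  obtain ⟨B, hB⟩ := coercive d n hdn β hα hα' hc
  have e : c * (α+2) * (-(mC d n β α c) / c - β^2/8)
      = (α+2) * (-β^2 * c / 8 - mC d n β α c) := by
    field_simp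
    ring
  rw [e]
  refine ⟨?_, mul_pos (by positivity) (by linarith)⟩
  have hlow : ∀ k, (α+2) * (-β^2 * c / 8 - En d n β α (u k)) ≤ Npow d n (α+2) (u k) := by
    intro k
    have h1 := quad' (hu k).1 β
    rw [(hu k).2] at h1
    have h2 : -β^2 * c / 8 - En d n β α (u k) ≤ 1/(α+2) * Npow d n (α+2) (u k) := by
      unfold En; linarith
    have h3 := mul_le_mul_of_nonneg_left h2 (show 0 ≤ α + 2 by positivity)
    refine h3.trans (le_of_eq ?_)
    field_simp
  have htend : Tendsto (fun k => (α+2) * (-β^2 * c / 8 - En d n β α (u k))) atTop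
      (nhds ((α+2) * (-β^2 * c / 8 - mC d n β α c))) :=
    (tendsto_const_nhds.sub hmin).const_mul _
  rw [← htend.liminf_eq]
  refine liminf_le_liminf (Eventually.of_forall hlow) htend.isBoundedUnder_ge ?_
  have hup : Tendsto (fun k => (α+2) * En d n β α (u k) + B) atTop
      (nhds ((α+2) * mC d n β α c + B)) := (hmin.const_mul _).add_const _
  refine IsBoundedUnder.isCoboundedUnder_ge ?_
  exact hup.isBoundedUnder_le.mono_le (Eventually.of_forall fun k => (hB _ (hu k)).2)
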